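/- Suppose B : ℝ × ℝ³ → ℝ³ is C¹ and satisfies the incompressible Lagrangian magnetic equation ∂_t B = B·∇_A u with u = ∂_t η, that div_A u ≡ 0, that J(0,x) = 1 for all x, and that B(0,x) = ∇η(0,x) B̄ for some constant vector B̄ ∈ ℝ³ and all x. Then B(t,x) = ∇η(t,x) B̄ for all (t,x) ∈ ℝ × ℝ³. -/

import Mathlib

open Matrix

/-- The spatial Jacobian matrix `∇η(t,x)` of a time-dependent map
`η : ℝ × ℝ³ → ℝ³`, with entries `(∇η)_{ij} = ∂η_i/∂x_j`. -/
noncomputable def jacTD (η : ℝ × (Fin 3 → ℝ) → Fin 3 → ℝ) (t : ℝ) (x : Fin 3 → ℝ) :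
    Matrix (Fin 3) (Fin 3) ℝ :=
  Matrix.of fun i j => fderiv ℝ (fun y => η (t, y) i) x (Pi.single j 1)

/-- The Jacobian determinant `J(t,x) = det ∇η(t,x)`. -/
noncomputable def Jdet (η : ℝ × (Fin 3 → ℝ) → Fin 3 → ℝ) (t : ℝ) (x : Fin 3 → ℝ) : ℝ :=
  (jacTD η t x).det

/-- The matrix `A(t,x) = ((∇η(t,x))⁻¹)ᵀ`. -/
noncomputable def Amat (η : ℝ × (Fin 3 → ℝ) → Fin 3 → ℝ) (t : ℝ) (x : Fin 3 → ℝ) :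
    Matrix (Fin 3) (Fin 3) ℝ :=
  ((jacTD η t x)⁻¹)ᵀ

/-- The Lagrangian velocity `u = ∂_t η`. -/
noncomputable def uvel (η : ℝ × (Fin 3 → ℝ) → Fin 3 → ℝ) (p : ℝ × (Fin 3 → ℝ)) :
    Fin 3 → ℝ :=
  fun i => deriv (fun s => η (s, p.2) i) p.1

/-- `div_A X = ∑_{i,j} A_{ij} ∂_j X_i` for a time-dependent vector field `X`. -/
noncomputable def divA (η X : ℝ × (Fin 3 → ℝ) → Fin 3 → ℝ) (t : ℝ) (x : Fin 3 → ℝ) : ℝ :=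
  ∑ i : Fin 3, ∑ j : Fin 3,
    Amat η t x i j * fderiv ℝ (fun y => X (t, y) i) x (Pi.single j 1)

/-- Spatial derivative of a slice. -/
lemma aux_space (f : ℝ × (Fin 3 → ℝ) → ℝ) (t : ℝ) (x v : Fin 3 → ℝ)
    (hf : DifferentiableAt ℝ f (t, x)) :
    fderiv ℝ (fun y => f (t, y)) x v = fderiv ℝ f (t, x) (0, v) := by
  have h2 : HasFDerivAt (fun y : Fin 3 → ℝ => (t, y))
      (ContinuousLinearMap.inr ℝ ℝ (Fin 3 → ℝ)) x := hasFDerivAt_prodMk_right t x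
  have h := (hf.hasFDerivAt.comp x h2).fderiv
  have h3 : fderiv ℝ (fun y => f (t, y)) x
      = (fderiv ℝ f (t, x)).comp (ContinuousLinearMap.inr ℝ ℝ (Fin 3 → ℝ)) := h
  rw [h3]
  simp

/-- Time derivative of a slice. -/
lemma aux_time (f : ℝ × (Fin 3 → ℝ) → ℝ) (t : ℝ) (x : Fin 3 → ℝ)
    (hf : DifferentiableAt ℝ f (t, x)) :
    HasDerivAt (fun s => f (s, x)) (fderiv ℝ f (t, x) (1, 0)) t := by
  have h2 : HasDerivAt (fun s : ℝ => (s, x)) ((1 : ℝ), (0 : Fin 3 → ℝ)) t :=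
    (hasDerivAt_id t).prodMk (hasDerivAt_const t x)
  exact hf.hasFDerivAt.comp_hasDerivAt t h2

/-- `∂_t ∇η = ∇u`. -/
lemma aux_jac (η : ℝ × (Fin 3 → ℝ) → Fin 3 → ℝ) (hη : ContDiff ℝ 2 η)
    (t : ℝ) (x : Fin 3 → ℝ) (i k : Fin 3) :
    HasDerivAt (fun s => jacTD η s x i k)
      (fderiv ℝ (fun y => uvel η (t, y) i) x (Pi.single k 1)) t := by
  have hf : ContDiff ℝ 2 (fun p => η p i) := contDiff_pi.1 hη i
  generalize hfd : (fun p => η p i) = f at hf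
  have hfe : ∀ p, η p i = f p := fun p => by rw [← hfd]
  have hd : Differentiable ℝ f := hf.differentiable (by norm_num)
  have hd2 : Differentiable ℝ (fderiv ℝ f) :=
    (hf.fderiv_right (m := 1) (by norm_num)).differentiable (by norm_num)
  have hj : (fun s => jacTD η s x i k)
      = fun s => (fun p => fderiv ℝ f p (0, Pi.single k 1)) (s, x) := by
    funext s
    simp only [jacTD, Matrix.of_apply, hfe]
    exact aux_space f s x _ (hd _)
  have hu : (fun y => uvel η (t, y) i) = fun y => (fun p => fderiv ℝ f p (1, 0)) (t, y) := by
    funext y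
    simp only [uvel, hfe]
    exact (aux_time f t y (hd _)).deriv
  have hda : ∀ (v p : ℝ × (Fin 3 → ℝ)), HasFDerivAt (fun p => fderiv ℝ f p v)
      ((fderiv ℝ (fderiv ℝ f) p).flip v) p := by
    intro v p
    have := (hd2 p).hasFDerivAt.clm_apply (hasFDerivAt_const v p)
    have h0 : (fderiv ℝ f p).comp (0 : (ℝ × (Fin 3 → ℝ)) →L[ℝ] (ℝ × (Fin 3 → ℝ)))
        + (fderiv ℝ (fderiv ℝ f) p).flip v = (fderiv ℝ (fderiv ℝ f) p).flip v := by
      rw [ContinuousLinearMap.comp_zero, zero_add]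
    exact h0 ▸ this
  rw [hj, hu, aux_space _ t x _ (hda _ _).differentiableAt, (hda _ _).fderiv]
  have := aux_time _ t x (hda (0, Pi.single k 1) (t, x)).differentiableAt
  rw [(hda _ _).fderiv] at this
  convert this using 1
  have hs : IsSymmSndFDerivAt ℝ f (t, x) :=
    hf.contDiffAt.isSymmSndFDerivAt (by simp)
  simpa using hs _ _

/-- The inverse of a differentiable invertible matrix path is differentiable. -/
lemma aux_inv (F : ℝ → Matrix (Fin 3) (Fin 3) ℝ) (h0 : ∀ t, (F t).det ≠ 0)
    (hF : ∀ i j, Differentiable ℝ (fun t => F t i j)) (i j : Fin 3) :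
    Differentiable ℝ (fun t => (F t)⁻¹ i j) := by
  have hdet : Differentiable ℝ (fun t => (F t).det) := by
    simp only [Matrix.det_fin_three]
    fun_prop
  have hadj : Differentiable ℝ (fun t => (F t).adjugate i j) := by
    simp only [Matrix.adjugate_fin_three]
    fin_cases i <;> fin_cases j <;> simp <;> fun_prop
  have : (fun t => (F t)⁻¹ i j) = fun t => (F t).det⁻¹ * (F t).adjugate i j := by
    funext t
    simp [Matrix.inv_def]
  rw [this]
  exact (hdet.inv h0).mul hadj

/-- if `B` solves the incompressible Lagrangian magnetic equation
`∂_t B = B·∇_A u`, `div_A u ≡ 0`, `J(0,·) = 1`, and `B(0,·) = ∇η(0,·) B̄`, then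
`B(t,·) = ∇η(t,·) B̄` for all times. -/
theorem magnetic_field_formula_incompressible
    (η : ℝ × (Fin 3 → ℝ) → Fin 3 → ℝ) (hη : ContDiff ℝ 2 η)
    (hinv : ∀ (t : ℝ) (x : Fin 3 → ℝ), (jacTD η t x).det ≠ 0)
    (B : ℝ × (Fin 3 → ℝ) → Fin 3 → ℝ) (hB : ContDiff ℝ 1 B)
    (heq : ∀ (t : ℝ) (x : Fin 3 → ℝ) (i : Fin 3),
      deriv (fun s => B (s, x) i) t =
        ∑ j : Fin 3, ∑ k : Fin 3,
          B (t, x) j * Amat η t x j k *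
            fderiv ℝ (fun y => uvel η (t, y) i) x (Pi.single k 1))
    (hdiv : ∀ (t : ℝ) (x : Fin 3 → ℝ), divA η (uvel η) t x = 0)
    (hJ0 : ∀ x : Fin 3 → ℝ, Jdet η 0 x = 1)
    (Bbar : Fin 3 → ℝ)
    (hB0 : ∀ x : Fin 3 → ℝ, B (0, x) = (jacTD η 0 x).mulVec Bbar) :
    ∀ (t : ℝ) (x : Fin 3 → ℝ), B (t, x) = (jacTD η t x).mulVec Bbar := by
  intro t x
  set F : ℝ → Matrix (Fin 3) (Fin 3) ℝ := fun s => jacTD η s x with hF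
  set U : ℝ → Matrix (Fin 3) (Fin 3) ℝ := fun s => Matrix.of fun i k =>
    fderiv ℝ (fun y => uvel η (s, y) i) x (Pi.single k 1) with hU
  have hFd : ∀ s i k, HasDerivAt (fun s => F s i k) (U s i k) s :=
    fun s i k => aux_jac η hη s x i k
  have hBd : ∀ i, Differentiable ℝ (fun s => B (s, x) i) := fun i s =>
    (aux_time (fun p => B p i) s x
      (((contDiff_pi.1 hB i).differentiable (by norm_num)) _)).differentiableAt
  have hunit : ∀ s, IsUnit (F s).det := fun s => isUnit_iff_ne_zero.2 (hinv s x)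
  set C : ℝ → Fin 3 → ℝ := fun s => (F s)⁻¹ *ᵥ B (s, x) with hC
  have hCd : ∀ i, Differentiable ℝ (fun s => C s i) := by
    intro i
    have h := aux_inv F (fun s => hinv s x) (fun i j s => (hFd s i j).differentiableAt) i
    simp only [hC, Matrix.mulVec, dotProduct]
    exact Differentiable.fun_sum fun j _ => (h j).mul (hBd j)
  have hBFC : ∀ s, B (s, x) = F s *ᵥ C s := by
    intro s
    simp only [hC, Matrix.mulVec_mulVec, Matrix.mul_nonsing_inv _ (hunit s), Matrix.one_mulVec]
  have hder : ∀ s, (fun i => deriv (fun s => C s i) s) = 0 := by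
    intro s
    have key : F s *ᵥ (fun i => deriv (fun s => C s i) s) = 0 := by
      funext i
      have h1 : HasDerivAt (fun s => B (s, x) i)
          (∑ j, (U s i j * C s j + F s i j * deriv (fun s => C s j) s)) s := by
        have : (fun s => B (s, x) i) = fun s => ∑ j, F s i j * C s j := by
          funext r
          rw [hBFC r]
          rfl
        rw [this]
        exact HasDerivAt.fun_sum fun j _ => (hFd s i j).mul (hCd j s).hasDerivAt
      have h2 := heq s x i
      have h3 : (∑ j : Fin 3, ∑ k : Fin 3, B (s, x) j * Amat η s x j k *
            fderiv ℝ (fun y => uvel η (s, y) i) x (Pi.single k 1)) = ∑ k, U s i k * C s k := by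
        rw [Finset.sum_comm]
        refine Finset.sum_congr rfl fun k _ => ?_
        simp only [hC, Matrix.mulVec, dotProduct, Finset.mul_sum, hU, Matrix.of_apply, Amat,
          Matrix.transpose_apply, hF]
        exact Finset.sum_congr rfl fun j _ => by ring
      rw [h1.deriv, h3, Finset.sum_add_distrib] at h2
      simp only [Matrix.mulVec, dotProduct, Pi.zero_apply]
      linarith
    have := congrArg (fun v => (F s)⁻¹ *ᵥ v) key
    simpa [Matrix.mulVec_mulVec, Matrix.nonsing_inv_mul _ (hunit s)] using this
  have hC0 : C 0 = Bbar := by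
    simp only [hC, hB0 x]
    change (F 0)⁻¹ *ᵥ (F 0 *ᵥ Bbar) = Bbar
    rw [Matrix.mulVec_mulVec, Matrix.nonsing_inv_mul _ (hunit 0), Matrix.one_mulVec]
  have hCt : C t = C 0 := by
    funext i
    exact is_const_of_deriv_eq_zero (hCd i) (fun s => congrFun (hder s) i) t 0
  rw [hBFC t, hCt, hC0]
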